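/- arXiv:2508.08499 — 4 statements merged into one kernel-verified Lean document; each statement's English description precedes it below -/
import Mathlib

section
/- Fix t ∈ [0,1) and a* ∈ ℝ. Let P be a probability measure on ℝ^d, let π, π̂ : ℝ^d × ℝ → (0,∞) be measurable with ∫_ℝ π(x,a) da = ∫_ℝ π̂(x,a) da = 1 for every x, and let μ, μ̂ : ℝ^d × ℝ → ℝ be measurable. Define ν_t(x,a) = (1/(1−t)) π(x,(a − t·a*)/(1−t)), ν̂_t(x,a) = (1/(1−t)) π̂(x,(a − t·a*)/(1−t)), λ_a = (1−t)a + t·a*, the functionals ψ(μ̄,π̄) = ∫_{ℝ^d}∫_ℝ μ̄(x,a) ν̄_t(x,a) da dP(x), and φ(x,a,y; μ̄,π̄) = (ν̄_t(x,a)/π̄(x,a))(y − μ̄(x,a)) + μ̄(x,λ_a) − ψ(μ̄,π̄). Let p(y|x,a) be a measurable conditional outcome density on ℝ (∫ p(y|x,a) dy = 1) with μ(x,a) = ∫_ℝ y·p(y|x,a) dy, and assume all integrals below converge absolutely. Then the von Mises remainder satisfies the exact identity ∫∫∫ φ(x,a,y; μ̂,π̂) p(y|x,a) π(x,a) dy da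 dP(x) + ψ(μ̂,π̂) − ψ(μ,π) = ∫∫ (μ(x,a) − μ̂(x,a)) · (ν̂_t(x,a)/π̂(x,a) − ν_t(x,a)/π(x,a)) · π(x,a) da dP(x), a second-order product of the errors in μ and in the intervention likelihood ratio. -/
open MeasureTheory

/-- The Wasserstein intervention density `ν_t(x,a) = (1/(1−t)) π(x, (a − t·a*)/(1−t))`. -/
noncomputable def nuW {d : ℕ} (t astar : ℝ) (pi : (Fin d → ℝ) → ℝ → ℝ)
    (x : Fin d → ℝ) (a : ℝ) : ℝ :=
  (1 / (1 - t)) * pi x ((a - t * astar) / (1 - t))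

/-- The functional `ψ(μ̄,π̄) = ∫∫ μ̄(x,a) ν̄_t(x,a) da dP(x)`. -/
noncomputable def psiW {d : ℕ} (t astar : ℝ) (P : Measure (Fin d → ℝ))
    (mu pi : (Fin d → ℝ) → ℝ → ℝ) : ℝ :=
  ∫ x, (∫ a, mu x a * nuW t astar pi x a) ∂P

/-- The (candidate) influence function
`φ(x,a,y;μ̄,π̄) = (ν̄_t/π̄)(y − μ̄) + μ̄(x,λ_a) − ψ(μ̄,π̄)` with `λ_a = (1−t)a + t·a*`. -/
noncomputable def phiW {d : ℕ} (t astar : ℝ) (P : Measure (Fin d → ℝ))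
    (mu pi : (Fin d → ℝ) → ℝ → ℝ) (x : Fin d → ℝ) (a y : ℝ) : ℝ :=
  (nuW t astar pi x a / pi x a) * (y - mu x a)
    + mu x ((1 - t) * a + t * astar) - psiW t astar P mu pi

/-- Truncation at level one after rescaling is controlled by the relative error. -/
lemma abs_min_one_mul_sub_le {n x y : ℝ} (hn : 0 ≤ n) (hx : 0 < x) (hy : 0 < y) :
    |min 1 (n * x) - min 1 (n * y)| ≤ |x / y - 1| := by
  have hxy : x / y * y = x := div_mul_cancel₀ x hy.ne'
  have hr : 0 < x / y := div_pos hx hy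
  set r := x / y
  rw [← hxy]
  have hny : 0 ≤ n * y := by positivity
  have e : n * (r * y) = r * (n * y) := by ring
  rw [e]
  generalize n * y = z at hny
  have h1 := le_abs_self (r - 1)
  have h2 := neg_abs_le (r - 1)
  rw [abs_le]
  rcases le_total 1 z with hz | hz <;> rcases le_total 1 (r * z) with hrz | hrz <;>
    simp only [min_eq_left, min_eq_right, hz, hrz] <;> constructor <;>
    rcases abs_cases (r - 1) with ⟨h, h'⟩ | ⟨h, h'⟩ <;> rw [h] <;> nlinarith

lemma tendsto_min_one_natCast_mul {x : ℝ} (hx : 0 < x) :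
    Filter.Tendsto (fun n : ℕ => min 1 ((n : ℝ) * x)) Filter.atTop (nhds 1) := by
  apply tendsto_const_nhds.congr'
  filter_upwards [(tendsto_natCast_atTop_atTop.atTop_mul_const hx).eventually_ge_atTop 1]
    with n hn using (min_eq_left hn).symm

lemma integrable_mul_comp_affine {s : ℝ} (hs : 0 < s) (c : ℝ) {G : ℝ → ℝ} (hG : Integrable G) :
    Integrable (fun a => s * G (s * a + c)) :=
  ((hG.comp_add_right c).comp_mul_left' hs.ne').const_mul s

lemma integral_mul_comp_affine {s : ℝ} (hs : 0 < s) (c : ℝ) (G : ℝ → ℝ) :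
    ∫ a, s * G (s * a + c) = ∫ a, G a := by
  rw [integral_const_mul, Measure.integral_comp_mul_left (fun a => G (a + c)),
    integral_add_right_eq_self G c, abs_of_pos (inv_pos.2 hs), smul_eq_mul,
    mul_inv_cancel_left₀ hs.ne']

/-- A cocycle `s * g (s a + c) - g a` has integral zero even though `g` itself need not be
integrable, provided `g` is integrable against some positive weight `k` whose relative variation
along the affine map is integrable against `g`, up to an integrable error `f`. -/
lemma integral_affine_cocycle_eq_zero {s : ℝ} (hs : 0 < s) (c : ℝ) {f g k : ℝ → ℝ}
    (hg : Measurable g) (hk : Measurable k) (hk_pos : ∀ a, 0 < k a) (hf : Integrable f)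
    (hgk : Integrable (fun a => g a * k ((a - c) / s)))
    (hfg : Integrable (fun a => (f a - g a) * (k ((a - c) / s) / k a - 1)))
    (hh : Integrable (fun a => s * g (s * a + c) - g a)) :
    ∫ a, (s * g (s * a + c) - g a) = 0 := by
  have hinv (a : ℝ) : (s * a + c - c) / s = a := by field_simp; ring
  set chi : ℕ → ℝ → ℝ := fun n a => min 1 ((n : ℝ) * k a) with hchi
  have chi_meas (n) : Measurable (chi n) := measurable_const.min (hk.const_mul _)
  have chi_nonneg (n a) : 0 ≤ chi n a := le_min zero_le_one (by have := hk_pos a; positivity)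
  have chi_le (n a) : chi n a ≤ 1 := min_le_left _ _
  have meas_inv : Measurable (fun a : ℝ => (a - c) / s) := by fun_prop
  have chi_lim (a) : Filter.Tendsto (fun n => chi n a) Filter.atTop (nhds 1) :=
    tendsto_min_one_natCast_mul (hk_pos a)
  have int_pull (n) : Integrable (fun a => g a * chi n ((a - c) / s)) := by
    refine (hgk.const_mul (n : ℝ)).mono
      (hg.mul ((chi_meas n).comp meas_inv)).aestronglyMeasurable (ae_of_all _ fun a => ?_)
    have hpos := hk_pos ((a - c) / s)
    simp only [Real.norm_eq_abs, abs_mul, abs_of_pos hpos, abs_of_nonneg (chi_nonneg _ _),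
      Nat.abs_cast]
    calc |g a| * chi n ((a - c) / s) ≤ |g a| * (n * k ((a - c) / s)) := by
          gcongr; exact min_le_right _ _
      _ = _ := by ring
  have int_push (n) : Integrable (fun a => s * g (s * a + c) * chi n a) := by
    simpa only [hinv, mul_assoc] using integrable_mul_comp_affine hs c (int_pull n)
  have int_h (n) : Integrable (fun a => (s * g (s * a + c) - g a) * chi n a) := by
    refine hh.mono (hh.aestronglyMeasurable.mul (chi_meas n).aestronglyMeasurable)
      (ae_of_all _ fun a => ?_)
    rw [norm_mul, Real.norm_of_nonneg (chi_nonneg n a)]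
    exact mul_le_of_le_one_right (norm_nonneg _) (chi_le n a)
  have int_g (n) : Integrable (fun a => g a * chi n a) := by
    refine ((int_push n).sub (int_h n)).congr (ae_of_all _ fun a => ?_)
    simp only [Pi.sub_apply]; ring
  have key (n) : ∫ a, (s * g (s * a + c) - g a) * chi n a
      = ∫ a, g a * (chi n ((a - c) / s) - chi n a) := by
    have e := integral_mul_comp_affine hs c (fun a => g a * chi n ((a - c) / s))
    simp only [hinv, ← mul_assoc] at e
    simp only [sub_mul, mul_sub]
    rw [integral_sub (int_push n) (int_g n), integral_sub (int_pull n) (int_g n), e]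
  have lim_left : Filter.Tendsto (fun n => ∫ a, (s * g (s * a + c) - g a) * chi n a)
      Filter.atTop (nhds (∫ a, (s * g (s * a + c) - g a))) := by
    refine tendsto_integral_of_dominated_convergence _
      (fun n => (int_h n).aestronglyMeasurable) hh.norm
      (fun n => ae_of_all _ fun a => ?_) (ae_of_all _ fun a => ?_)
    · rw [norm_mul, Real.norm_of_nonneg (chi_nonneg n a)]
      exact mul_le_of_le_one_right (norm_nonneg _) (chi_le n a)
    · simpa using (chi_lim a).const_mul (s * g (s * a + c) - g a)
  have lim_right : Filter.Tendsto (fun n => ∫ a, g a * (chi n ((a - c) / s) - chi n a))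
      Filter.atTop (nhds (∫ _ : ℝ, (0 : ℝ))) := by
    refine tendsto_integral_of_dominated_convergence _
      (fun n => (hg.mul (((chi_meas n).comp meas_inv).sub (chi_meas n))).aestronglyMeasurable)
      (hfg.norm.add hf.norm)
      (fun n => ae_of_all _ fun a => ?_) (ae_of_all _ fun a => ?_)
    · have h1 : |chi n ((a - c) / s) - chi n a| ≤ |k ((a - c) / s) / k a - 1| :=
        abs_min_one_mul_sub_le (Nat.cast_nonneg n) (hk_pos _) (hk_pos _)
      have h2 : |chi n ((a - c) / s) - chi n a| ≤ 1 := by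
        rw [abs_le]
        constructor <;> linarith [chi_nonneg n a, chi_le n a, chi_nonneg n ((a - c) / s),
          chi_le n ((a - c) / s)]
      have h3 : |g a| ≤ |f a - g a| + |f a| := by
        have := abs_sub (f a) (f a - g a)
        rw [sub_sub_cancel] at this; linarith
      simp only [Pi.add_apply, Real.norm_eq_abs, abs_mul]
      calc |g a| * |chi n ((a - c) / s) - chi n a|
          ≤ (|f a - g a| + |f a|) * |chi n ((a - c) / s) - chi n a| := by gcongr
        _ = |f a - g a| * |chi n ((a - c) / s) - chi n a|
            + |f a| * |chi n ((a - c) / s) - chi n a| := add_mul _ _ _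
        _ ≤ |f a - g a| * |k ((a - c) / s) / k a - 1| + |f a| * 1 := by gcongr
        _ = _ := by rw [mul_one]
    · simpa using ((chi_lim ((a - c) / s)).sub (chi_lim a)).const_mul (g a)
  simp only [key] at lim_left
  simpa using tendsto_nhds_unique lim_left lim_right

/-- Averaging `r * (y - m) + b` against a density `q` with mean `mu`; integrability of `y * q y`
follows from that of the average because `r ≠ 0`. -/
lemma integral_affine_mul_density {q : ℝ → ℝ} {r m b mu : ℝ} (hr : r ≠ 0)
    (hq : ∫ y, q y = 1) (hmu : mu = ∫ y, y * q y)
    (hint : Integrable (fun y => (r * (y - m) + b) * q y)) :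
    ∫ y, (r * (y - m) + b) * q y = r * (mu - m) + b := by
  have hqi : Integrable q := integrable_of_integral_eq_one hq
  have hyq : Integrable (fun y => y * q y) := by
    refine ((hint.sub (hqi.const_mul (b - r * m))).const_mul r⁻¹).congr (ae_of_all _ fun y => ?_)
    simp only [Pi.sub_apply]
    field_simp
    ring
  have e (y : ℝ) : (r * (y - m) + b) * q y = r * (y * q y) + (b - r * m) * q y := by ring
  simp only [e]
  rw [integral_add (hyq.const_mul r) (hqi.const_mul _), integral_const_mul, integral_const_mul,
    hq, ← hmu]
  ring

/-- exact second-order von Mises remainder identity for the Wasserstein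
incremental effect. -/
theorem stmt_1 {d : ℕ} (t : ℝ) (ht : t ∈ Set.Ico (0:ℝ) 1) (astar : ℝ)
    (P : Measure (Fin d → ℝ)) [IsProbabilityMeasure P]
    (pi pihat mu muhat : (Fin d → ℝ) → ℝ → ℝ)
    (p : (Fin d → ℝ) → ℝ → ℝ → ℝ)
    (hpi_meas : Measurable (Function.uncurry pi))
    (hpihat_meas : Measurable (Function.uncurry pihat))
    (hmu_meas : Measurable (Function.uncurry mu))
    (hmuhat_meas : Measurable (Function.uncurry muhat))
    (hp_meas : Measurable (fun z : (Fin d → ℝ) × ℝ × ℝ => p z.1 z.2.1 z.2.2))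
    (hpi_pos : ∀ x a, 0 < pi x a) (hpihat_pos : ∀ x a, 0 < pihat x a)
    (hpi_dens : ∀ x, ∫ a, pi x a = 1) (hpihat_dens : ∀ x, ∫ a, pihat x a = 1)
    (hp_dens : ∀ x a, ∫ y, p x a y = 1)
    (hmu_def : ∀ x a, mu x a = ∫ y, y * p x a y)
    -- absolute convergence of all integrals involved:
    (hI1 : ∀ x a, Integrable (fun y => phiW t astar P muhat pihat x a y * p x a y))
    (hI2 : ∀ x, Integrable
      (fun a => (∫ y, phiW t astar P muhat pihat x a y * p x a y) * pi x a))
    (hI3 : Integrable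
      (fun x => ∫ a, (∫ y, phiW t astar P muhat pihat x a y * p x a y) * pi x a) P)
    (hI4 : ∀ x, Integrable (fun a => mu x a * nuW t astar pi x a))
    (hI5 : Integrable (fun x => ∫ a, mu x a * nuW t astar pi x a) P)
    (hI6 : ∀ x, Integrable (fun a => muhat x a * nuW t astar pihat x a))
    (hI7 : Integrable (fun x => ∫ a, muhat x a * nuW t astar pihat x a) P)
    (hI8 : ∀ x, Integrable (fun a => (mu x a - muhat x a) *
      (nuW t astar pihat x a / pihat x a - nuW t astar pi x a / pi x a) * pi x a))
    (hI9 : Integrable (fun x => ∫ a, (mu x a - muhat x a) *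
      (nuW t astar pihat x a / pihat x a - nuW t astar pi x a / pi x a) * pi x a) P) :
    (∫ x, (∫ a, (∫ y, phiW t astar P muhat pihat x a y * p x a y) * pi x a) ∂P)
        + psiW t astar P muhat pihat - psiW t astar P mu pi
      = ∫ x, (∫ a, (mu x a - muhat x a) *
          (nuW t astar pihat x a / pihat x a - nuW t astar pi x a / pi x a) * pi x a) ∂P := by
  have hs : 0 < 1 - t := sub_pos.2 ht.2
  have hnu (x a) : 0 < nuW t astar pihat x a := mul_pos (by positivity) (hpihat_pos _ _)
  set C := psiW t astar P muhat pihat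
  have inner (x a) : ∫ y, phiW t astar P muhat pihat x a y * p x a y
      = nuW t astar pihat x a / pihat x a * (mu x a - muhat x a)
        + (muhat x ((1 - t) * a + t * astar) - C) := by
    have h := hI1 x a
    simp only [phiW, add_sub_assoc] at h ⊢
    exact integral_affine_mul_density (div_pos (hnu x a) (hpihat_pos x a)).ne' (hp_dens x a)
      (hmu_def x a) h
  simp only [inner] at hI2 hI3 ⊢
  have slice (x) : ∫ a, (mu x a - muhat x a) *
        (nuW t astar pihat x a / pihat x a - nuW t astar pi x a / pi x a) * pi x a
      = (∫ a, (nuW t astar pihat x a / pihat x a * (mu x a - muhat x a)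
        + (muhat x ((1 - t) * a + t * astar) - C)) * pi x a) + C
        - ∫ a, mu x a * nuW t astar pi x a := by
    have hpi_int : Integrable (pi x) := integrable_of_integral_eq_one (hpi_dens x)
    have hpi_x : Measurable (pi x) := hpi_meas.comp measurable_prodMk_left
    have hpihat_x : Measurable (pihat x) := hpihat_meas.comp measurable_prodMk_left
    have hmuhat_x : Measurable (muhat x) := hmuhat_meas.comp measurable_prodMk_left
    have hcoc (a : ℝ) : (1 - t) * (muhat x ((1 - t) * a + t * astar)
          * nuW t astar pi x ((1 - t) * a + t * astar)) - muhat x a * nuW t astar pi x a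
        = (nuW t astar pihat x a / pihat x a * (mu x a - muhat x a)
            + (muhat x ((1 - t) * a + t * astar) - C)) * pi x a + C * pi x a
          - mu x a * nuW t astar pi x a
          - (mu x a - muhat x a) *
            (nuW t astar pihat x a / pihat x a - nuW t astar pi x a / pi x a) * pi x a := by
      have h0 := (hpi_pos x a).ne'
      have e : nuW t astar pi x ((1 - t) * a + t * astar) = 1 / (1 - t) * pi x a := by
        rw [nuW, add_sub_cancel_right, mul_div_cancel_left₀ _ hs.ne']
      rw [e]
      field_simp
      ring
    have hsum := ((hI2 x).add (hpi_int.const_mul C)).sub (hI4 x)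
    have hzero := integral_affine_cocycle_eq_zero hs (t * astar)
      (f := fun a => mu x a * nuW t astar pi x a)
      (g := fun a => muhat x a * nuW t astar pi x a)
      (k := fun a => pihat x a / pi x a)
      (hmuhat_x.mul ((hpi_x.comp (by fun_prop)).const_mul _)) (hpihat_x.div hpi_x)
      (fun a => div_pos (hpihat_pos x a) (hpi_pos x a)) (hI4 x)
      ((hI6 x).congr (ae_of_all _ fun a => by
        have := (hpi_pos x ((a - t * astar) / (1 - t))).ne'
        simp only [nuW]; field_simp))
      ((hI8 x).congr (ae_of_all _ fun a => by
        have := (hpi_pos x ((a - t * astar) / (1 - t))).ne'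
        have := (hpi_pos x a).ne'
        have := (hpihat_pos x a).ne'
        simp only [nuW]; field_simp))
      ((hsum.sub (hI8 x)).congr (ae_of_all _ fun a => (hcoc a).symm))
    simp only [hcoc] at hzero
    have e1 := integral_sub hsum (hI8 x)
    have e2 := integral_sub ((hI2 x).add (hpi_int.const_mul C)) (hI4 x)
    have e3 := integral_add (hI2 x) (hpi_int.const_mul C)
    simp only [Pi.add_apply, Pi.sub_apply] at e1 e2 e3
    rw [integral_const_mul, hpi_dens, mul_one] at e3
    linarith
  simp only [slice]
  have e1 := integral_sub (hI3.add (integrable_const C)) hI5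
  have e2 := integral_add hI3 (integrable_const C)
  simp only [Pi.add_apply] at e1 e2
  rw [e1, e2]
  simp [psiW]
end

section
/- Fix t ∈ [0,1), a* ∈ [0,1], and constants 0 < π_min ≤ π_max < ∞. Let P be a probability measure on ℝ^d and let π, π̂ : ℝ^d × [0,1] → ℝ be measurable conditional densities with ∫₀¹ π(x,a) da = ∫₀¹ π̂(x,a) da = 1 and π_min ≤ π(x,a), π̂(x,a) ≤ π_max for all x and all a ∈ [0,1]. Let μ, μ̂ : ℝ^d × [0,1] → ℝ be measurable with ‖μ̂ − μ‖₂ < ∞, where ‖f‖₂² = ∫∫₀¹ f(x,a)² π(x,a) da dP(x). Define ν_t(x,a) = (1/(1−t)) π(x,(a − t·a*)/(1−t)) when (a − t·a*)/(1−t) ∈ [0,1] and ν_t(x,a) = 0 otherwise, and ν̂_t analogously from π̂. Then | ∫∫₀¹ (μ(x,a) − μ̂(x,a)) · (ν̂_t(x,a)/π̂(x,a) − ν_t(x,a)/π(x,a)) · π(x,a) da dP(x) | ≤ ( 1/(π_min √(1−t)) + π_max/(π_min² (1−t)) ) · ‖μ̂ − μ‖₂ · ‖π̂ − π‖₂. 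-/
open MeasureTheory

/-- The Wasserstein intervention density on `[0,1]`:
`ν_t(x,a) = (1/(1−t)) π(x,(a − t·a*)/(1−t))` when `(a − t·a*)/(1−t) ∈ [0,1]`, else `0`. -/
noncomputable def nuT {d : ℕ} (t astar : ℝ) (pi : (Fin d → ℝ) → ℝ → ℝ)
    (x : Fin d → ℝ) (a : ℝ) : ℝ :=
  if (a - t * astar) / (1 - t) ∈ Set.Icc (0:ℝ) 1
  then (1 / (1 - t)) * pi x ((a - t * astar) / (1 - t)) else 0

/-- Cauchy–Schwarz inequality for a weighted `L²` pairing. -/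
theorem abs_integral_mul_mul_le_sqrt {α : Type*} [MeasurableSpace α] {m : Measure α}
    {e w p : α → ℝ} (he : Measurable e) (hw : Measurable w) (hp : Measurable p)
    (hp0 : ∀ᵐ z ∂m, 0 ≤ p z) (hep : Integrable (fun z => e z ^ 2 * p z) m)
    (hwp : Integrable (fun z => w z ^ 2 * p z) m) :
    |∫ z, e z * w z * p z ∂m|
      ≤ Real.sqrt (∫ z, e z ^ 2 * p z ∂m) * Real.sqrt (∫ z, w z ^ 2 * p z ∂m) := by
  have sq_eq (f : α → ℝ) : ∀ᵐ z ∂m, (|f z| * Real.sqrt (p z)) ^ 2 = f z ^ 2 * p z := by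
    filter_upwards [hp0] with z hz
    rw [mul_pow, sq_abs, Real.sq_sqrt hz]
  have memLp {f : α → ℝ} (hf : Measurable f) (hfp : Integrable (fun z => f z ^ 2 * p z) m) :
      MemLp (fun z => |f z| * Real.sqrt (p z)) (ENNReal.ofReal 2) m := by
    rw [ENNReal.ofReal_ofNat, memLp_two_iff_integrable_sq
      (by fun_prop : Measurable fun z => |f z| * Real.sqrt (p z)).aestronglyMeasurable]
    exact hfp.congr ((sq_eq f).mono fun z hz => hz.symm)
  have key := integral_mul_le_Lp_mul_Lq_of_nonneg (μ := m) Real.HolderConjugate.two_two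
    (.of_forall fun z => by positivity) (.of_forall fun z => by positivity)
    (memLp he hep) (memLp hw hwp)
  simp only [Real.rpow_two, ← Real.sqrt_eq_rpow] at key
  rw [integral_congr_ae (sq_eq e), integral_congr_ae (sq_eq w)] at key
  refine (abs_integral_le_integral_abs).trans (le_of_eq_of_le (integral_congr_ae ?_) key)
  filter_upwards [hp0] with z hz
  rw [abs_mul, abs_mul, abs_of_nonneg hz, mul_mul_mul_comm, Real.mul_self_sqrt hz]

/-- The quadratic form `K * (E + r * D) ^ 2` is dominated by a diagonal one, uniformly for
`r` between `1 / R` and `R`. -/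
theorem mul_sq_add_mul_le {K R r : ℝ} (hK : 1 ≤ K) (hr : 0 < r) (hrR : r ≤ R)
    (hRr : 1 ≤ R * r) (E D : ℝ) :
    K * (E + r * D) ^ 2 ≤ (K + K ^ 2 * R) * r * E ^ 2 + (K * R ^ 2 + R) * D ^ 2 := by
  have hR : 1 ≤ R := by nlinarith
  have hKRr : 0 ≤ (K - 1) * (R * r - 1) := mul_nonneg (by linarith) (by linarith)
  -- The difference of the two sides is a quadratic form in `E` and `D` with leading coefficient
  -- given by `hα` and discriminant condition `hdisc`.
  have hα : 0 < r + K * R * r - 1 := by nlinarith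
  have hβ : R ≤ K * (R ^ 2 - r ^ 2) + R :=
    le_add_of_nonneg_left (mul_nonneg (by linarith) (by nlinarith))
  have hdisc : K * r ^ 2 ≤ (r + K * R * r - 1) * (K * (R ^ 2 - r ^ 2) + R) := by
    refine le_trans ?_ (mul_le_mul_of_nonneg_left hβ hα.le)
    rcases le_total 1 r with h | h
    · have h1 : K * R * r ≤ r + K * R * r - 1 := by linarith
      have h2 : r ^ 2 ≤ R * r * R := by nlinarith [mul_le_mul hrR hrR hr.le (by linarith)]
      nlinarith [mul_le_mul_of_nonneg_right h1 (by linarith : (0:ℝ) ≤ R)]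
    · have h1 : K * r ≤ r + K * R * r - 1 := by nlinarith
      calc K * r ^ 2 = K * r * r := by ring
        _ ≤ (r + K * R * r - 1) * R := mul_le_mul h1 hrR hr.le hα.le
  have hK0 : 0 < K := by linarith
  have hid : (r + K * R * r - 1) * ((K + K ^ 2 * R) * r * E ^ 2 + (K * R ^ 2 + R) * D ^ 2
        - K * (E + r * D) ^ 2)
      = K * ((r + K * R * r - 1) * E - r * D) ^ 2
        + ((r + K * R * r - 1) * (K * (R ^ 2 - r ^ 2) + R) - K * r ^ 2) * D ^ 2 := by ring
  have hnn : 0 ≤ (r + K * R * r - 1) * ((K + K ^ 2 * R) * r * E ^ 2 + (K * R ^ 2 + R) * D ^ 2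
        - K * (E + r * D) ^ 2) := by
    rw [hid]
    exact add_nonneg (by positivity) (mul_nonneg (by linarith) (sq_nonneg D))
  linarith [nonneg_of_mul_nonneg_right hnn hα]

theorem sq_div_sub_div_mul_le {K m M p q phat qhat : ℝ} (hK : 1 ≤ K) (hm : 0 < m)
    (hp : m ≤ p) (hpM : p ≤ M) (hq : m ≤ q) (hqM : q ≤ M) (hphat : m ≤ phat) :
    K * (qhat / phat - q / p) ^ 2 * p
      ≤ ((K + K ^ 2 * (M / m)) * ((qhat - q) ^ 2 * q)
          + (K * (M / m) ^ 2 + M / m) * ((phat - p) ^ 2 * p)) / m ^ 2 := by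
  have hp0 : 0 < p := hm.trans_le hp
  have hq0 : 0 < q := hm.trans_le hq
  have hphat0 : 0 < phat := hm.trans_le hphat
  have hM0 : 0 < M := hp0.trans_le hpM
  have hrR : q / p ≤ M / m := div_le_div₀ hM0.le hqM hm hp
  have hRr : 1 ≤ M / m * (q / p) := by
    rw [div_mul_div_comm, one_le_div (by positivity)]
    nlinarith
  have key := mul_sq_add_mul_le hK (div_pos hq0 hp0) hrR hRr (qhat - q) (-(phat - p))
  have hdiff : qhat / phat - q / p = (qhat - q + q / p * -(phat - p)) / phat := by
    field_simp
    ring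
  calc K * (qhat / phat - q / p) ^ 2 * p
      = K * (qhat - q + q / p * -(phat - p)) ^ 2 * p / phat ^ 2 := by rw [hdiff]; ring
    _ ≤ K * (qhat - q + q / p * -(phat - p)) ^ 2 * p / m ^ 2 := by gcongr
    _ ≤ _ := by
      gcongr
      calc _ ≤ _ := mul_le_mul_of_nonneg_right key hp0.le
        _ = _ := by field_simp

/-- Pulling a nonnegative function on `[0,1]` back along `a ↦ (a - b) / L` multiplies its
integral by at most `L`. -/
theorem setIntegral_indicator_comp_le {L b : ℝ} (hL : 0 < L) {f : ℝ → ℝ}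
    (hf0 : ∀ a ∈ Set.Icc (0:ℝ) 1, 0 ≤ f a) (hf : IntegrableOn f (Set.Icc 0 1)) (s : Set ℝ) :
    IntegrableOn (fun a => (Set.Icc (0:ℝ) 1).indicator f ((a - b) / L)) s ∧
    ∫ a in s, (Set.Icc (0:ℝ) 1).indicator f ((a - b) / L) ≤ L * ∫ a in (0:ℝ)..1, f a := by
  have hint : Integrable (fun a => (Set.Icc (0:ℝ) 1).indicator f ((a - b) / L)) :=
    ((hf.integrable_indicator measurableSet_Icc).comp_div hL.ne').comp_sub_right b
  refine ⟨hint.integrableOn, (setIntegral_le_integral hint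
    (.of_forall fun a => Set.indicator_nonneg hf0 _)).trans_eq ?_⟩
  rw [integral_sub_right_eq_self (fun a => (Set.Icc (0:ℝ) 1).indicator f (a / L)) b,
    Measure.integral_comp_div, integral_indicator measurableSet_Icc, integral_Icc_eq_integral_Ioc,
    ← intervalIntegral.integral_of_le zero_le_one, abs_of_pos hL, smul_eq_mul]

theorem measurable_uncurry_nuT {d : ℕ} {pi : (Fin d → ℝ) → ℝ → ℝ} (t astar : ℝ)
    (hpi : Measurable (Function.uncurry pi)) :
    Measurable (Function.uncurry (nuT t astar pi)) := by
  have hs : Measurable fun z : (Fin d → ℝ) × ℝ => (z.2 - t * astar) / (1 - t) := by fun_prop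
  exact Measurable.ite (hs measurableSet_Icc)
    ((hpi.comp (measurable_fst.prodMk hs)).const_mul _) measurable_const

/-- Pointwise bound on the density-ratio error. -/
theorem sq_nuT_div_sub_mul_le {d : ℕ} {t astar πmin πmax : ℝ} (ht : t ∈ Set.Ico (0:ℝ) 1)
    (hπmin : 0 < πmin) {pi pihat : (Fin d → ℝ) → ℝ → ℝ} (x : Fin d → ℝ)
    (hpi_bd : ∀ a ∈ Set.Icc (0:ℝ) 1, πmin ≤ pi x a ∧ pi x a ≤ πmax)
    (hpihat_bd : ∀ a ∈ Set.Icc (0:ℝ) 1, πmin ≤ pihat x a ∧ pihat x a ≤ πmax)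
    {K R : ℝ} (hK : K = 1 / Real.sqrt (1 - t)) (hR : R = πmax / πmin)
    {a : ℝ} (ha : a ∈ Set.Icc (0:ℝ) 1) :
    (nuT t astar pihat x a / pihat x a - nuT t astar pi x a / pi x a) ^ 2 * pi x a
      ≤ (K ^ 4 + K ^ 5 * R) / πmin ^ 2 *
          (Set.Icc (0:ℝ) 1).indicator (fun s => (pihat x s - pi x s) ^ 2 * pi x s)
            ((a - t * astar) / (1 - t))
        + (K ^ 4 * R ^ 2 + K ^ 3 * R) / πmin ^ 2 * ((pihat x a - pi x a) ^ 2 * pi x a) := by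
  have hL : 0 < 1 - t := by linarith [ht.2]
  have hK1 : 1 ≤ K := by
    rw [hK, one_le_div (Real.sqrt_pos.2 hL)]
    exact Real.sqrt_le_one.2 (by linarith [ht.1])
  have hKsq : 1 / (1 - t) = K ^ 2 := by rw [hK, div_pow, one_pow, Real.sq_sqrt hL.le]
  have hp := hpi_bd a ha
  have hphat := hpihat_bd a ha
  have hp0 : 0 < pi x a := hπmin.trans_le hp.1
  have hR0 : 0 < R := hR ▸ div_pos (hp0.trans_le hp.2) hπmin
  unfold nuT
  by_cases hs : (a - t * astar) / (1 - t) ∈ Set.Icc (0:ℝ) 1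
  · have hq := hpi_bd _ hs
    rw [if_pos hs, if_pos hs, Set.indicator_of_mem hs, hKsq]
    have key := sq_div_sub_div_mul_le (qhat := pihat x ((a - t * astar) / (1 - t)))
      hK1 hπmin hp.1 hp.2 hq.1 hq.2 hphat.1
    rw [← hR] at key
    calc _ = K ^ 3 * (K * (pihat x ((a - t * astar) / (1 - t)) / pihat x a
              - pi x ((a - t * astar) / (1 - t)) / pi x a) ^ 2 * pi x a) := by ring
      _ ≤ _ := mul_le_mul_of_nonneg_left key (by positivity)
      _ = _ := by ring
  · rw [if_neg hs, if_neg hs, Set.indicator_of_notMem hs]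
    simp only [zero_div, sub_zero, mul_zero, zero_add, zero_pow two_ne_zero, zero_mul]
    positivity


/-- the von Mises remainder of the Wasserstein incremental effect is
bounded by `(1/(π_min √(1−t)) + π_max/(π_min²(1−t)))·‖μ̂ − μ‖₂·‖π̂ − π‖₂`. -/
theorem stmt_9 {d : ℕ} (t astar : ℝ) (ht : t ∈ Set.Ico (0:ℝ) 1)
    (hastar : astar ∈ Set.Icc (0:ℝ) 1)
    (πmin πmax : ℝ) (hπmin : 0 < πmin) (hminmax : πmin ≤ πmax)
    (P : Measure (Fin d → ℝ)) [IsProbabilityMeasure P]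
    (pi pihat mu muhat : (Fin d → ℝ) → ℝ → ℝ)
    (hpi_meas : Measurable (Function.uncurry pi))
    (hpihat_meas : Measurable (Function.uncurry pihat))
    (hmu_meas : Measurable (Function.uncurry mu))
    (hmuhat_meas : Measurable (Function.uncurry muhat))
    (hpi_dens : ∀ x, ∫ a in (0:ℝ)..1, pi x a = 1)
    (hpihat_dens : ∀ x, ∫ a in (0:ℝ)..1, pihat x a = 1)
    (hpi_bd : ∀ x, ∀ a ∈ Set.Icc (0:ℝ) 1, πmin ≤ pi x a ∧ pi x a ≤ πmax)
    (hpihat_bd : ∀ x, ∀ a ∈ Set.Icc (0:ℝ) 1, πmin ≤ pihat x a ∧ pihat x a ≤ πmax)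
    -- ‖μ̂ − μ‖₂ < ∞:
    (hmu_err_int : ∀ x, IntegrableOn (fun a => (muhat x a - mu x a)^2 * pi x a)
      (Set.Icc 0 1))
    (hmu_err_int' : Integrable
      (fun x => ∫ a in (0:ℝ)..1, (muhat x a - mu x a)^2 * pi x a) P) :
    |∫ x, (∫ a in (0:ℝ)..1, (mu x a - muhat x a) *
        (nuT t astar pihat x a / pihat x a - nuT t astar pi x a / pi x a) * pi x a) ∂P|
      ≤ (1 / (πmin * Real.sqrt (1 - t)) + πmax / (πmin^2 * (1 - t)))
        * Real.sqrt (∫ x, (∫ a in (0:ℝ)..1, (muhat x a - mu x a)^2 * pi x a) ∂P)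
        * Real.sqrt (∫ x, (∫ a in (0:ℝ)..1, (pihat x a - pi x a)^2 * pi x a) ∂P) := by
  set lam : Measure ℝ := volume.restrict (Set.Ioc 0 1) with hlam
  simp only [intervalIntegral.integral_of_le (zero_le_one' ℝ)] at hmu_err_int' ⊢
  rw [← hlam] at hmu_err_int' ⊢
  set w : (Fin d → ℝ) → ℝ → ℝ := fun x a =>
    nuT t astar pihat x a / pihat x a - nuT t astar pi x a / pi x a with hw
  set K : ℝ := 1 / Real.sqrt (1 - t) with hK
  set R : ℝ := πmax / πmin with hR
  have hL : 0 < 1 - t := by linarith [ht.2]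
  have hK0 : 0 < K := one_div_pos.2 (Real.sqrt_pos.2 hL)
  have hR0 : 0 < R := div_pos (hπmin.trans_le hminmax) hπmin
  have hKL : K ^ 2 * (1 - t) = 1 := by
    rw [hK, div_pow, one_pow, Real.sq_sqrt hL.le, one_div_mul_cancel hL.ne']
  have hw_meas : Measurable (Function.uncurry w) :=
    ((measurable_uncurry_nuT t astar hpihat_meas).div hpihat_meas).sub
      ((measurable_uncurry_nuT t astar hpi_meas).div hpi_meas)
  have hae : ∀ᵐ z ∂P.prod lam, z.2 ∈ Set.Icc (0:ℝ) 1 :=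
    Measure.quasiMeasurePreserving_snd.ae
      ((ae_restrict_mem measurableSet_Ioc).mono fun a ha => Set.Ioc_subset_Icc_self ha)
  have hpi0 : ∀ x, ∀ a ∈ Set.Icc (0:ℝ) 1, 0 ≤ pi x a :=
    fun x a ha => hπmin.le.trans (hpi_bd x a ha).1
  have hg_bd : ∀ x, ∀ a ∈ Set.Icc (0:ℝ) 1, (pihat x a - pi x a) ^ 2 * pi x a ≤ πmax ^ 3 := by
    intro x a ha
    have h1 := hpi_bd x a ha
    have h2 := hpihat_bd x a ha
    calc _ ≤ πmax ^ 2 * πmax :=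
          mul_le_mul (sq_le_sq' (by linarith) (by linarith)) h1.2 (hpi0 x a ha) (by positivity)
      _ = πmax ^ 3 := by ring
  have hg0 : ∀ x, ∀ a ∈ Set.Icc (0:ℝ) 1, 0 ≤ (pihat x a - pi x a) ^ 2 * pi x a :=
    fun x a ha => mul_nonneg (sq_nonneg _) (hpi0 x a ha)
  have hg_meas : Measurable
      (Function.uncurry fun x a => (pihat x a - pi x a) ^ 2 * pi x a) :=
    ((hpihat_meas.sub hpi_meas).pow_const 2).mul hpi_meas
  have hg_int : Integrable
      (Function.uncurry fun x a => (pihat x a - pi x a) ^ 2 * pi x a) (P.prod lam) := by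
    refine Integrable.of_bound hg_meas.aestronglyMeasurable (πmax ^ 3) ?_
    filter_upwards [hae] with z hz
    exact (Real.norm_of_nonneg (hg0 z.1 z.2 hz)).trans_le (hg_bd z.1 z.2 hz)
  have hg_slice : ∀ x, IntegrableOn (fun a => (pihat x a - pi x a) ^ 2 * pi x a)
      (Set.Icc 0 1) := by
    intro x
    refine Integrable.of_bound (hg_meas.comp measurable_prodMk_left).aestronglyMeasurable
      (πmax ^ 3) ((ae_restrict_mem measurableSet_Icc).mono fun a ha => ?_)
    rw [Real.norm_of_nonneg (hg0 x a ha)]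
    exact hg_bd x a ha
  have hw_le : ∀ x, ∀ a ∈ Set.Icc (0:ℝ) 1, _ := fun x a ha =>
    sq_nuT_div_sub_mul_le (astar := astar) ht hπmin x (hpi_bd x) (hpihat_bd x) hK hR ha
  have hw_meas2 : Measurable (Function.uncurry fun x a => w x a ^ 2 * pi x a) :=
    (hw_meas.pow_const 2).mul hpi_meas
  have hw_int : Integrable (Function.uncurry fun x a => w x a ^ 2 * pi x a) (P.prod lam) := by
    refine Integrable.of_bound hw_meas2.aestronglyMeasurable
      ((K ^ 4 + K ^ 5 * R) / πmin ^ 2 * πmax ^ 3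
        + (K ^ 4 * R ^ 2 + K ^ 3 * R) / πmin ^ 2 * πmax ^ 3) ?_
    filter_upwards [hae] with z hz
    have hπmax : 0 < πmax := hπmin.trans_le hminmax
    refine (Real.norm_of_nonneg (mul_nonneg (sq_nonneg (w z.1 z.2))
      (hpi0 z.1 z.2 hz))).trans_le ((hw_le z.1 z.2 hz).trans ?_)
    gcongr
    · exact Set.indicator_le' (fun s hs => hg_bd z.1 s hs) (fun _ _ => by positivity) _
    · exact hg_bd z.1 z.2 hz
  have he_meas : Measurable (Function.uncurry fun x a => mu x a - muhat x a) :=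
    hmu_meas.sub hmuhat_meas
  have he_int : Integrable (Function.uncurry fun x a => (mu x a - muhat x a) ^ 2 * pi x a)
      (P.prod lam) := by
    have he_meas2 : Measurable (Function.uncurry fun x a => (mu x a - muhat x a) ^ 2 * pi x a) :=
      (he_meas.pow_const 2).mul hpi_meas
    rw [integrable_prod_iff he_meas2.aestronglyMeasurable]
    simp only [Function.uncurry_apply_pair, sub_sq_comm (mu _ _)]
    refine ⟨.of_forall fun x => (hmu_err_int x).mono_set Set.Ioc_subset_Icc_self,
      hmu_err_int'.congr (.of_forall fun x => setIntegral_congr_fun measurableSet_Ioc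
        fun a ha => ?_)⟩
    exact (Real.norm_of_nonneg
      (mul_nonneg (sq_nonneg _) (hpi0 x a (Set.Ioc_subset_Icc_self ha)))).symm
  have hpi0_ae : ∀ᵐ z ∂P.prod lam, 0 ≤ Function.uncurry pi z :=
    hae.mono fun z hz => hpi0 z.1 z.2 hz
  have hCS := abs_integral_mul_mul_le_sqrt he_meas hw_meas hpi_meas hpi0_ae he_int hw_int
  have hew_int : Integrable
      (Function.uncurry fun x a => (mu x a - muhat x a) * w x a * pi x a) (P.prod lam) := by
    refine (he_int.add hw_int).mono' ((he_meas.mul hw_meas).mul hpi_meas).aestronglyMeasurable ?_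
    filter_upwards [hpi0_ae] with z hz
    change |(mu z.1 z.2 - muhat z.1 z.2) * w z.1 z.2 * pi z.1 z.2|
      ≤ (mu z.1 z.2 - muhat z.1 z.2) ^ 2 * pi z.1 z.2 + w z.1 z.2 ^ 2 * pi z.1 z.2
    replace hz : 0 ≤ pi z.1 z.2 := hz
    rw [abs_mul, abs_of_nonneg hz, ← add_mul]
    refine mul_le_mul_of_nonneg_right (abs_le.2 ⟨?_, ?_⟩) hz <;>
      nlinarith [sq_nonneg (mu z.1 z.2 - muhat z.1 z.2 + w z.1 z.2),
        sq_nonneg (mu z.1 z.2 - muhat z.1 z.2 - w z.1 z.2)]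
  have hslice : ∀ x, (∫ a, w x a ^ 2 * pi x a ∂lam)
      ≤ ((K + K ^ 2 * R) / πmin) ^ 2 * ∫ a, (pihat x a - pi x a) ^ 2 * pi x a ∂lam := by
    intro x
    obtain ⟨hi, hle⟩ := setIntegral_indicator_comp_le (b := t * astar) hL (hg0 x) (hg_slice x)
      (Set.Ioc 0 1)
    rw [intervalIntegral.integral_of_le zero_le_one, ← hlam] at hle
    have hg' := (hg_slice x).mono_set (Set.Ioc_subset_Icc_self (a := (0:ℝ)) (b := 1))
    calc _ ≤ _ := integral_mono_of_nonneg
            ((ae_restrict_mem measurableSet_Ioc).mono fun a ha =>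
              mul_nonneg (sq_nonneg _) (hpi0 x a (Set.Ioc_subset_Icc_self ha)))
            ((hi.const_mul _).add (hg'.const_mul _))
            ((ae_restrict_mem measurableSet_Ioc).mono fun a ha =>
              hw_le x a (Set.Ioc_subset_Icc_self ha))
      _ = _ := integral_add (hi.const_mul _) (hg'.const_mul _)
      _ ≤ (K ^ 4 + K ^ 5 * R) / πmin ^ 2 *
              ((1 - t) * ∫ a, (pihat x a - pi x a) ^ 2 * pi x a ∂lam)
            + (K ^ 4 * R ^ 2 + K ^ 3 * R) / πmin ^ 2 *
              ∫ a, (pihat x a - pi x a) ^ 2 * pi x a ∂lam := by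
          rw [integral_const_mul, integral_const_mul]
          gcongr
      _ = ((K ^ 2 + K ^ 3 * R) * (K ^ 2 * (1 - t)) + (K ^ 4 * R ^ 2 + K ^ 3 * R)) / πmin ^ 2 *
              ∫ a, (pihat x a - pi x a) ^ 2 * pi x a ∂lam := by ring
      _ = _ := by rw [hKL]; ring
  have hw_total : (∫ x, ∫ a, w x a ^ 2 * pi x a ∂lam ∂P) ≤ ((K + K ^ 2 * R) / πmin) ^ 2 *
      ∫ x, ∫ a, (pihat x a - pi x a) ^ 2 * pi x a ∂lam ∂P := by
    rw [← integral_const_mul]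
    exact integral_mono hw_int.integral_prod_left (hg_int.integral_prod_left.const_mul _) hslice
  have hconst : 1 / (πmin * Real.sqrt (1 - t)) + πmax / (πmin ^ 2 * (1 - t))
      = (K + K ^ 2 * R) / πmin := by
    rw [hK, hR, div_pow, Real.sq_sqrt hL.le]
    have := (Real.sqrt_pos.2 hL).ne'
    field_simp
  have hE : (∫ x, ∫ a, (muhat x a - mu x a) ^ 2 * pi x a ∂lam ∂P)
      = ∫ z, Function.uncurry (fun x a => (mu x a - muhat x a) ^ 2 * pi x a) z ∂P.prod lam := by
    rw [integral_prod _ he_int]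
    simp only [Function.uncurry_apply_pair, sub_sq_comm (mu _ _)]
  have hW : (∫ x, ∫ a, w x a ^ 2 * pi x a ∂lam ∂P)
      = ∫ z, Function.uncurry (fun x a => w x a ^ 2 * pi x a) z ∂P.prod lam :=
    (integral_prod _ hw_int).symm
  have hsqrt := Real.sqrt_le_sqrt hw_total
  rw [Real.sqrt_mul (sq_nonneg _), Real.sqrt_sq (by positivity), hW] at hsqrt
  rw [hconst, hE]
  calc _ = |∫ z, Function.uncurry
            (fun x a => (mu x a - muhat x a) * w x a * pi x a) z ∂P.prod lam| := by
          rw [integral_prod _ hew_int]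
          rfl
    _ ≤ _ := hCS
    _ ≤ _ := mul_le_mul_of_nonneg_left hsqrt (Real.sqrt_nonneg _)
    _ = _ := by
      simp only [Function.uncurry_def]
      ring
end

section
/- Let π : ℝ → (0,∞) be continuously differentiable with ∫_{−∞}^{∞} |π′(z)/π(z)| dz ≤ M < ∞. Then for all a, u ∈ ℝ, π(u)/π(a) ≤ e^M. Consequently, for every t ∈ [0,1) and a* ∈ ℝ, the Wasserstein intervention density ν_t(a) = (1/(1−t)) π((a − t·a*)/(1−t)) satisfies ν_t(a)/π(a) ≤ e^M/(1−t) for all a ∈ ℝ. -/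
open MeasureTheory

/-- The oscillation of the logarithm of a positive `C¹` function is at most the integral of the
absolute value of its logarithmic derivative. -/
theorem log_sub_log_le_integral_abs_logDeriv {f : ℝ → ℝ} (hf : ContDiff ℝ 1 f)
    (hpos : ∀ z, 0 < f z) (hint : Integrable (fun z => |deriv f z / f z|)) (a u : ℝ) :
    Real.log (f u) - Real.log (f a) ≤ ∫ z, |deriv f z / f z| := by
  have hcont : Continuous fun z => deriv f z / f z :=
    (hf.continuous_deriv le_rfl).div hf.continuous fun z => (hpos z).ne'
  have hderiv : ∀ z, HasDerivAt (fun z => Real.log (f z)) (deriv f z / f z) z := fun z =>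
    ((hf.differentiable one_ne_zero) z).hasDerivAt.log (hpos z).ne'
  rw [← intervalIntegral.integral_eq_sub_of_hasDerivAt (fun z _ => hderiv z)
    (hcont.intervalIntegrable a u)]
  calc ∫ z in a..u, deriv f z / f z
      ≤ ‖∫ z in a..u, deriv f z / f z‖ := Real.le_norm_self _
    _ ≤ ∫ z in Set.uIoc a u, |deriv f z / f z| :=
        intervalIntegral.norm_integral_le_integral_norm_uIoc
    _ ≤ ∫ z, |deriv f z / f z| :=
        setIntegral_le_integral hint (Filter.Eventually.of_forall fun z => abs_nonneg _)

/-- if `∫ |π′/π| ≤ M` then `π(u)/π(a) ≤ e^M` for all `a, u`, and hence the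
Wasserstein intervention likelihood ratio satisfies `ν_t(a)/π(a) ≤ e^M/(1−t)`. -/
theorem stmt_10 (pi : ℝ → ℝ) (M : ℝ)
    (hpi_C1 : ContDiff ℝ 1 pi) (hpi_pos : ∀ z, 0 < pi z)
    (hint : Integrable (fun z => |deriv pi z / pi z|))
    (hM : (∫ z, |deriv pi z / pi z|) ≤ M) :
    (∀ a u : ℝ, pi u / pi a ≤ Real.exp M)
    ∧ ∀ t ∈ Set.Ico (0:ℝ) 1, ∀ astar a : ℝ,
        ((1 / (1 - t)) * pi ((a - t * astar) / (1 - t))) / pi a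
          ≤ Real.exp M / (1 - t) := by
  have hratio : ∀ a u : ℝ, pi u / pi a ≤ Real.exp M := by
    intro a u
    rw [← Real.log_le_iff_le_exp (div_pos (hpi_pos u) (hpi_pos a)),
      Real.log_div (hpi_pos u).ne' (hpi_pos a).ne']
    exact (log_sub_log_le_integral_abs_logDeriv hpi_C1 hpi_pos hint a u).trans hM
  refine ⟨hratio, fun t ht astar a => ?_⟩
  have ht' : 0 < 1 - t := sub_pos.mpr ht.2
  rw [mul_div_assoc, one_div, inv_mul_eq_div]
  exact div_le_div_of_nonneg_right (hratio _ _) ht'.le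
end

section
/- Let P be a probability measure on ℝ^d, let π : ℝ^d × ℝ → (0,∞) and q : ℝ^d × ℝ → [0,∞) be measurable conditional densities (∫ π(x,a) da = ∫ q(x,a) da = 1 for all x), and let p(y|x,a) be a measurable conditional outcome density on ℝ with mean μ₀(x,a) = ∫ y·p(y|x,a) dy and variance σ²(x,a) = ∫ (y − μ₀(x,a))² p(y|x,a) dy. For ε ∈ ℝ define φ_y(x,a,y) = (q(x,a)/π(x,a))·(y − μ₀(x,a)) and the fluctuated conditional outcome density p₁(y|x,a) = p(y|x,a)·(1 + ε·φ_y(x,a,y)), with mean μ₁(x,a) = ∫ y·p₁(y|x,a) dy. Assume all integrals converge absolutely. Then: (i) ∫ p₁(y|x,a) dy = 1 for all (x,a); (ii) the stochastic-intervention functionals ψ_i = ∫∫ μ_i(x,a) q(x,a) da dP(x) (i = 0,1) satisfy ψ₁ − ψ₀ = ε · ∫∫ (q(x,a)/π(x,a))² σ²(x,a) π(x,a) da dP(x); and (iii) the chi-squared divergence between the joint densities p_i(x,a,y) = π(x,a)·p_i(y|x,a) relative to P satisfies ∫∫∫ (p₁ − p₀)²/p₀ · dy da dP(x) = ε² ·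 ∫∫ (q(x,a)/π(x,a))² σ²(x,a) π(x,a) da dP(x). -/
open MeasureTheory

/-- The first moment of a density about its mean vanishes. -/
theorem integrable_and_integral_centered_mul_density {f : ℝ → ℝ} {m : ℝ} (hf : Integrable f)
    (hyf : Integrable fun y => y * f y) (hf1 : ∫ y, f y = 1) (hm : m = ∫ y, y * f y) :
    Integrable (fun y => (y - m) * f y) ∧ ∫ y, (y - m) * f y = 0 := by
  have h : (fun y => (y - m) * f y) = fun y => y * f y - m * f y := by
    funext y; ring
  rw [h]
  refine ⟨hyf.sub (hf.const_mul m), ?_⟩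
  rw [integral_sub hyf (hf.const_mul m), integral_const_mul, hf1, ← hm]
  ring

/-- Tilting a density linearly about its mean preserves its total mass. -/
theorem integral_linear_tilt {f : ℝ → ℝ} {m : ℝ} (t : ℝ) (hf : Integrable f)
    (hyf : Integrable fun y => y * f y) (hf1 : ∫ y, f y = 1) (hm : m = ∫ y, y * f y) :
    ∫ y, f y * (1 + t * (y - m)) = 1 := by
  obtain ⟨hi, h0⟩ := integrable_and_integral_centered_mul_density hf hyf hf1 hm
  have h : (fun y => f y * (1 + t * (y - m))) = fun y => f y + t * ((y - m) * f y) := by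
    funext y; ring
  rw [h, integral_add hf (hi.const_mul t), integral_const_mul, hf1, h0]
  ring

/-- Tilting a density linearly about its mean with slope `t` moves the mean by `t` times the
variance. -/
theorem integral_mul_linear_tilt {f : ℝ → ℝ} {m : ℝ} (t : ℝ) (hf : Integrable f)
    (hyf : Integrable fun y => y * f y) (hvf : Integrable fun y => (y - m) ^ 2 * f y)
    (hf1 : ∫ y, f y = 1) (hm : m = ∫ y, y * f y) :
    ∫ y, y * (f y * (1 + t * (y - m))) = m + t * ∫ y, (y - m) ^ 2 * f y := by
  obtain ⟨hi, h0⟩ := integrable_and_integral_centered_mul_density hf hyf hf1 hm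
  have h : (fun y => y * (f y * (1 + t * (y - m)))) =
      fun y => y * f y + (t * ((y - m) ^ 2 * f y) + t * m * ((y - m) * f y)) := by
    funext y; ring
  have hsum : Integrable fun y => t * ((y - m) ^ 2 * f y) + t * m * ((y - m) * f y) :=
    (hvf.const_mul t).add (hi.const_mul (t * m))
  rw [h, integral_add hyf hsum,
    integral_add (hvf.const_mul t) (hi.const_mul (t * m)), integral_const_mul,
    integral_const_mul, h0, ← hm]
  ring

/-- The chi-squared integral between a scaled density and its linear tilt. -/
theorem integral_sq_sub_linear_tilt_div {f : ℝ → ℝ} {m r : ℝ} (t : ℝ) (hr : r ≠ 0) :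
    ∫ y, (r * (f y * (1 + t * (y - m))) - r * f y) ^ 2 / (r * f y) =
      t ^ 2 * r * ∫ y, (y - m) ^ 2 * f y := by
  rw [← integral_const_mul]
  congr 1
  funext y
  by_cases hy : f y = 0
  · simp [hy]
  · field_simp
    ring

/-- for the fluctuation `p₁ = p(1 + ε φ_y)` with
`φ_y = (q/π)(y − μ₀)`: (i) `p₁` integrates to one; (ii) the stochastic-intervention
functionals separate by `ε·∫∫ (q/π)² σ² π da dP`; (iii) the chi-squared divergence
between the joint densities equals `ε²` times the same quantity. -/
theorem stmt_18 {d : ℕ} (P : Measure (Fin d → ℝ)) [IsProbabilityMeasure P]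
    (pi q : (Fin d → ℝ) → ℝ → ℝ) (p : (Fin d → ℝ) → ℝ → ℝ → ℝ) (ε : ℝ)
    (hpi_meas : Measurable (Function.uncurry pi))
    (hq_meas : Measurable (Function.uncurry q))
    (hp_meas : Measurable (fun z : (Fin d → ℝ) × ℝ × ℝ => p z.1 z.2.1 z.2.2))
    (hpi_pos : ∀ x a, 0 < pi x a) (hq_nonneg : ∀ x a, 0 ≤ q x a)
    (hp_nonneg : ∀ x a y, 0 ≤ p x a y)
    (hpi_dens : ∀ x, ∫ a, pi x a = 1) (hq_dens : ∀ x, ∫ a, q x a = 1)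
    (hp_dens : ∀ x a, ∫ y, p x a y = 1)
    (μ0 σ2 : (Fin d → ℝ) → ℝ → ℝ)
    (hμ0 : ∀ x a, μ0 x a = ∫ y, y * p x a y)
    (hσ2 : ∀ x a, σ2 x a = ∫ y, (y - μ0 x a)^2 * p x a y)
    (φy : (Fin d → ℝ) → ℝ → ℝ → ℝ)
    (hφy : ∀ x a y, φy x a y = (q x a / pi x a) * (y - μ0 x a))
    (p1 : (Fin d → ℝ) → ℝ → ℝ → ℝ)
    (hp1 : ∀ x a y, p1 x a y = p x a y * (1 + ε * φy x a y))
    (μ1 : (Fin d → ℝ) → ℝ → ℝ)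
    (hμ1 : ∀ x a, μ1 x a = ∫ y, y * p1 x a y)
    -- absolute convergence of all integrals involved:
    (hIp : ∀ x a, Integrable (fun y => p x a y))
    (hIp1 : ∀ x a, Integrable (fun y => p1 x a y))
    (hIy : ∀ x a, Integrable (fun y => y * p x a y))
    (hIy1 : ∀ x a, Integrable (fun y => y * p1 x a y))
    (hIσ : ∀ x a, Integrable (fun y => (y - μ0 x a)^2 * p x a y))
    (hIμ0 : ∀ x, Integrable (fun a => μ0 x a * q x a))
    (hIμ1 : ∀ x, Integrable (fun a => μ1 x a * q x a))
    (hIμ0' : Integrable (fun x => ∫ a, μ0 x a * q x a) P)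
    (hIμ1' : Integrable (fun x => ∫ a, μ1 x a * q x a) P)
    (hIχa : ∀ x, Integrable (fun a => (q x a / pi x a)^2 * σ2 x a * pi x a))
    (hIχ : Integrable (fun x => ∫ a, (q x a / pi x a)^2 * σ2 x a * pi x a) P)
    (hIχy : ∀ x a, Integrable (fun y =>
      (pi x a * p1 x a y - pi x a * p x a y)^2 / (pi x a * p x a y)))
    (hIχa' : ∀ x, Integrable (fun a => ∫ y,
      (pi x a * p1 x a y - pi x a * p x a y)^2 / (pi x a * p x a y)))
    (hIχ' : Integrable (fun x => ∫ a, ∫ y,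
      (pi x a * p1 x a y - pi x a * p x a y)^2 / (pi x a * p x a y)) P) :
    (∀ x a, (∫ y, p1 x a y) = 1)
    ∧ ((∫ x, (∫ a, μ1 x a * q x a) ∂P) - (∫ x, (∫ a, μ0 x a * q x a) ∂P)
        = ε * ∫ x, (∫ a, (q x a / pi x a)^2 * σ2 x a * pi x a) ∂P)
    ∧ (∫ x, (∫ a, ∫ y,
          (pi x a * p1 x a y - pi x a * p x a y)^2 / (pi x a * p x a y)) ∂P
        = ε^2 * ∫ x, (∫ a, (q x a / pi x a)^2 * σ2 x a * pi x a) ∂P) := by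
  have hp1' : ∀ x a y, p1 x a y =
      p x a y * (1 + ε * (q x a / pi x a) * (y - μ0 x a)) := by
    intro x a y
    rw [hp1, hφy]
    ring
  refine ⟨fun x a => ?_, ?_, ?_⟩
  · simp only [hp1']
    exact integral_linear_tilt _ (hIp x a) (hIy x a) (hp_dens x a) (hμ0 x a)
  · have hmean : ∀ x a, μ1 x a * q x a - μ0 x a * q x a =
        ε * ((q x a / pi x a) ^ 2 * σ2 x a * pi x a) := by
      intro x a
      have hne := (hpi_pos x a).ne'
      rw [hμ1]
      simp only [hp1']
      rw [integral_mul_linear_tilt _ (hIp x a) (hIy x a) (hIσ x a) (hp_dens x a) (hμ0 x a),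
        ← hσ2]
      field_simp
      ring
    rw [← integral_sub hIμ1' hIμ0', ← integral_const_mul]
    congr 1
    funext x
    rw [← integral_sub (hIμ1 x) (hIμ0 x), ← integral_const_mul]
    simp only [hmean]
  · have hchi : ∀ x a, ∫ y, (pi x a * p1 x a y - pi x a * p x a y) ^ 2 / (pi x a * p x a y) =
        ε ^ 2 * ((q x a / pi x a) ^ 2 * σ2 x a * pi x a) := by
      intro x a
      simp only [hp1']
      rw [integral_sq_sub_linear_tilt_div _ (hpi_pos x a).ne', ← hσ2]
      ring
    simp only [hchi, integral_const_mul]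
end
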